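/- Jordan centrality criterion (comparison lemma): let T be a finite tree on n ≥ 3 vertices and define Ψ_T(v) = max over components C of T − v of |C|. For distinct vertices u, v ∈ T, let (T,v)_{u↓} denote the set of vertices w such that the path from w to v passes through u, and define (T,u)_{v↓} symmetrically. Then for any two distinct vertices u, v ∈ T, Ψ_T(u) ≤ Ψ_T(v) ⟺ |(T,v)_{u↓}| ≥ |(T,u)_{v↓}|. -/

import Mathlib

open Finset SimpleGraph

/-- For vertices `v ≠ u` of a graph `G`, `descSet G v u` is the set of vertices `w`
such that every path from `w` to `v` passes through `u` (when `G` is a tree rooted at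
`v`, this is the subtree consisting of `u` and its descendants). -/
def descSet {V : Type*} (G : SimpleGraph V) (v u : V) : Set V :=
  {w | ∀ p : G.Path w v, u ∈ p.1.support}

/-- The Jordan centrality of `v`: the maximal size of a subtree hanging off `v`. -/
noncomputable def jordanPsi {V : Type*} [Fintype V] [DecidableEq V]
    (G : SimpleGraph V) (v : V) : ℕ :=
  Finset.univ.sup (fun u => if u = v then 0 else (descSet G v u).ncard)

/-- A vertex lies outside `descSet G v u` iff some walk to `v` avoids `u`. -/
lemma notMem_descSet_iff {V : Type*} {G : SimpleGraph V} {v u w : V} :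
    w ∉ descSet G v u ↔ ∃ p : G.Walk w v, u ∉ p.support := by
  classical
  simp only [descSet, Set.mem_ofPred_eq, not_forall]
  exact ⟨fun ⟨p, hp⟩ => ⟨p.1, hp⟩,
    fun ⟨p, hp⟩ => ⟨p.toPath, fun h => hp (p.support_toPath_subset_support h)⟩⟩

lemma self_mem_descSet {V : Type*} (G : SimpleGraph V) (v u : V) : u ∈ descSet G v u :=
  fun p => p.1.start_mem_support

/-- Inside the subtree hanging at `x` one can reach `x` without visiting the root `u`. -/
lemma exists_walk_of_mem_descSet {V : Type*} {G : SimpleGraph V} (hG : G.Connected)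
    {u x w : V} (hx : x ≠ u) (hw : w ∈ descSet G u x) :
    ∃ p : G.Walk w x, u ∉ p.support := by
  classical
  obtain ⟨p, hp⟩ := hG.exists_isPath w u
  exact ⟨p.takeUntil x (hw ⟨p, hp⟩), Walk.endpoint_notMem_support_takeUntil hp _ hx.symm⟩

lemma disjoint_descSet {V : Type*} {G : SimpleGraph V} (hG : G.Connected)
    {u v : V} (huv : u ≠ v) : Disjoint (descSet G v u) (descSet G u v) :=
  Set.disjoint_right.2 fun _ hw =>
    notMem_descSet_iff.2 (exists_walk_of_mem_descSet hG huv.symm hw)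

/-- A subtree hanging off `u` lies either away from `v` or in the component towards `v`. -/
lemma descSet_subset_or_subset_compl {V : Type*} {G : SimpleGraph V} (hG : G.Connected)
    (v : V) {u x : V} (hx : x ≠ u) :
    descSet G u x ⊆ descSet G v u \ {u} ∨ descSet G u x ⊆ (descSet G v u)ᶜ := by
  by_contra! h
  obtain ⟨h₁, h₂⟩ := h
  obtain ⟨a, ha, ha'⟩ := Set.not_subset.1 h₁
  obtain ⟨b, hb, hb'⟩ := Set.not_subset.1 h₂
  obtain ⟨p, hp⟩ := exists_walk_of_mem_descSet hG hx ha
  obtain ⟨q, hq⟩ := exists_walk_of_mem_descSet hG hx hb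
  have hau : a ≠ u := fun h => hp (h ▸ p.start_mem_support)
  have hav : a ∉ descSet G v u := fun h => ha' ⟨h, hau⟩
  obtain ⟨r, hr⟩ := notMem_descSet_iff.1 hav
  refine hb' fun h => notMem_descSet_iff.2 ⟨(q.append p.reverse).append r, ?_⟩ h
  simp [Walk.mem_support_append_iff, hp, hq, hr]

/-- In a tree, the component of `T - u` containing `v` is a subtree hanging off `u`. -/
lemma exists_compl_descSet_subset {V : Type*} {G : SimpleGraph V} (hT : G.IsTree)
    {u v : V} (huv : u ≠ v) : ∃ x ≠ u, (descSet G v u)ᶜ ⊆ descSet G u x := by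
  classical
  obtain ⟨p, hp⟩ := hT.connected.exists_isPath u v
  cases p with
  | nil => exact absurd rfl huv
  | @cons _ x _ hadj q =>
    rw [Walk.cons_isPath_iff] at hp
    refine ⟨x, hadj.ne', fun w hw r => ?_⟩
    obtain ⟨s, hs⟩ := notMem_descSet_iff.1 hw
    let t : G.Walk w x := s.append q.reverse
    have ht : u ∉ t.bypass.support := fun h => by
      have := t.support_bypass_subset_support h
      simp [t, Walk.mem_support_append_iff, hs, hp.2] at this
    have hpath : (t.bypass.concat hadj.symm).IsPath := t.bypass_isPath.concat ht hadj.symm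
    rw [(hT.isAcyclic.subsingleton_path w u).elim r ⟨_, hpath⟩]
    simp [Walk.support_concat]

lemma ncard_descSet_le_jordanPsi {V : Type*} [Fintype V] [DecidableEq V]
    (G : SimpleGraph V) {u x : V} (hx : x ≠ u) :
    (descSet G u x).ncard ≤ jordanPsi G u := by
  simpa [jordanPsi, hx] using Finset.le_sup (f := fun x => if x = u then 0 else (descSet G u x).ncard)
    (Finset.mem_univ x)

lemma card_sub_le_jordanPsi {V : Type*} [Fintype V] [DecidableEq V]
    {G : SimpleGraph V} (hT : G.IsTree) {u v : V} (huv : u ≠ v) :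
    Fintype.card V - (descSet G v u).ncard ≤ jordanPsi G u := by
  obtain ⟨x, hx, hsub⟩ := exists_compl_descSet_subset hT huv
  rw [← Nat.card_eq_fintype_card, ← Set.ncard_compl]
  exact (Set.ncard_le_ncard hsub).trans (ncard_descSet_le_jordanPsi G hx)

lemma jordanPsi_le_max {V : Type*} [Fintype V] [DecidableEq V]
    {G : SimpleGraph V} (hG : G.Connected) (u v : V) :
    jordanPsi G u ≤
      max (Fintype.card V - (descSet G v u).ncard) ((descSet G v u).ncard - 1) := by
  refine Finset.sup_le fun x _ => ?_
  split_ifs with hx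
  · exact Nat.zero_le _
  rcases descSet_subset_or_subset_compl hG v hx with h | h
  · apply le_max_of_le_right
    rw [← Set.ncard_sdiff_singleton_of_mem (self_mem_descSet G v u)]
    exact Set.ncard_le_ncard h
  · apply le_max_of_le_left
    rw [← Nat.card_eq_fintype_card, ← Set.ncard_compl]
    exact Set.ncard_le_ncard h

/-- Jordan centrality comparison lemma: in a finite tree `T` on `n ≥ 3` vertices, for
distinct vertices `u, v`, `Ψ_T(u) ≤ Ψ_T(v)` iff `|(T,v)_{u↓}| ≥ |(T,u)_{v↓}|`. -/
theorem jordan_centrality_comparison {V : Type*} [Fintype V] [DecidableEq V]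
    (G : SimpleGraph V) (hT : G.IsTree) (hcard : 3 ≤ Fintype.card V)
    (u v : V) (huv : u ≠ v) :
    jordanPsi G u ≤ jordanPsi G v ↔
      (descSet G u v).ncard ≤ (descSet G v u).ncard := by
  have hu := card_sub_le_jordanPsi hT huv
  have hv := card_sub_le_jordanPsi hT huv.symm
  have hu' := jordanPsi_le_max hT.connected u v
  have hv' := jordanPsi_le_max hT.connected v u
  have hsum : (descSet G v u).ncard + (descSet G u v).ncard ≤ Fintype.card V := by
    rw [← Set.ncard_union_eq (disjoint_descSet hT.connected huv), ← Nat.card_eq_fintype_card]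
    exact Set.ncard_le_card _
  have hpos : 0 < (descSet G v u).ncard := (Set.ncard_pos).2 ⟨u, self_mem_descSet G v u⟩
  have hpos' : 0 < (descSet G u v).ncard := (Set.ncard_pos).2 ⟨v, self_mem_descSet G u v⟩
  omega
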